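/- For every 0 < β < 1 and every t > 0, the Wright-type transform of the hyperbolic cosine satisfies ∫_0^∞ g_β(s;t) cosh(s) ds = E_{2β}(t^{2β}) = ∑_{n=0}^∞ t^{2nβ} / Γ(2nβ + 1). -/

import Mathlib

open MeasureTheory Real Set Filter

/-- The Wright-type density `g_β(x;t) = t^{-β} ∑_{k} (−x/t^β)^k / (k! Γ(1 − β(k+1)))`. -/
noncomputable def wrightG (β x t : ℝ) : ℝ :=
  t ^ (-β) * ∑' k : ℕ, (-x / t ^ β) ^ k / ((Nat.factorial k : ℝ) * Real.Gamma (1 - β * (k + 1)))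

/-- The two-parameter Mittag-Leffler function `E_{β,α}(z) = ∑_k z^k / Γ(βk + α)`. -/
noncomputable def mittagLeffler (β α z : ℝ) : ℝ :=
  ∑' k : ℕ, z ^ k / Real.Gamma (β * k + α)

/-- The Caputo fractional derivative of order `β ∈ (0,1)`:
`D_c^β h(t) = (1/Γ(1−β)) ∫_0^t (t−τ)^{−β} h′(τ) dτ`. -/
noncomputable def caputo (β : ℝ) (h : ℝ → ℝ) (t : ℝ) : ℝ :=
  (1 / Real.Gamma (1 - β)) * ∫ τ in (0:ℝ)..t, (t - τ) ^ (-β) * deriv h τ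

/-- A function is of exponential order on `[0,∞)` if `|h(x)| ≤ C e^{a x}` there. -/
def ExpOrder (h : ℝ → ℝ) : Prop :=
  ∃ C a : ℝ, 0 < C ∧ 0 < a ∧ ∀ x : ℝ, 0 ≤ x → |h x| ≤ C * Real.exp (a * x)


lemma integrableOn_rpow_mul_cexp_neg_mul_Ioi {a : ℝ} (ha : -1 < a) {w : ℂ} (hw : 0 < w.re) :
    IntegrableOn (fun r : ℝ => ((r ^ a : ℝ) : ℂ) * Complex.exp (-w * r)) (Ioi 0) := by
  refine Integrable.mono' (integrableOn_rpow_mul_exp_neg_mul_rpow (p := 1) ha one_pos hw) ?_ ?_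
  · exact (by fun_prop : Measurable
      (fun r : ℝ => ((r ^ a : ℝ) : ℂ) * Complex.exp (-w * r))).aestronglyMeasurable
  · filter_upwards [ae_restrict_mem measurableSet_Ioi] with r hr
    have hr : 0 < r := hr
    rw [norm_mul, Complex.norm_exp, Complex.norm_real, Real.norm_of_nonneg (rpow_nonneg hr.le _)]
    simp

/-- Integration by parts for the Gamma integral with a complex rate. -/
lemma mul_integral_rpow_mul_cexp_neg_mul_Ioi {a : ℝ} (ha : 0 < a) {w : ℂ} (hw : 0 < w.re) :
    w * ∫ r in Ioi (0 : ℝ), ((r ^ a : ℝ) : ℂ) * Complex.exp (-w * r)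
      = a * ∫ r in Ioi (0 : ℝ), ((r ^ (a - 1) : ℝ) : ℂ) * Complex.exp (-w * r) := by
  have h1 := integrableOn_rpow_mul_cexp_neg_mul_Ioi (a := a) (by linarith) hw
  have h2 := integrableOn_rpow_mul_cexp_neg_mul_Ioi (a := a - 1) (by linarith) hw
  have key : ∫ r in Ioi (0 : ℝ), ((a : ℂ) * (((r ^ (a - 1) : ℝ) : ℂ) * Complex.exp (-w * r))
      - w * (((r ^ a : ℝ) : ℂ) * Complex.exp (-w * r))) = 0
        - ((((0 : ℝ) ^ a : ℝ) : ℂ) * Complex.exp (-w * (0 : ℝ))) := by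
    refine integral_Ioi_of_hasDerivAt_of_tendsto
      (f := fun r : ℝ => ((r ^ a : ℝ) : ℂ) * Complex.exp (-w * r)) ?_ ?_ ?_ ?_
    · refine ContinuousAt.continuousWithinAt ?_
      refine ContinuousAt.mul ?_ (by fun_prop)
      exact Complex.continuous_ofReal.continuousAt.comp
        (Real.continuousAt_rpow_const _ _ (Or.inr ha.le))
    · intro r hr
      have hr : 0 < r := hr
      have e1 := (Real.hasDerivAt_rpow_const (x := r) (p := a) (Or.inl hr.ne')).ofReal_comp
      have e2 : HasDerivAt (fun r : ℝ => Complex.exp (-w * r))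
          (Complex.exp (-w * r) * (-w * 1)) r :=
        ((Complex.ofRealCLM.hasDerivAt (x := r)).const_mul (-w)).cexp
      refine (e1.mul e2).congr_deriv ?_
      push_cast
      ring
    · exact (h2.const_mul _).sub (h1.const_mul _)
    · rw [tendsto_zero_iff_norm_tendsto_zero]
      refine (tendsto_rpow_mul_exp_neg_mul_atTop_nhds_zero a w.re hw).congr' ?_
      filter_upwards [eventually_gt_atTop 0] with r hr
      rw [norm_mul, Complex.norm_exp, Complex.norm_real, Real.norm_of_nonneg (rpow_nonneg hr.le _)]
      simp
  rw [integral_sub (h2.const_mul _) (h1.const_mul _), integral_const_mul, integral_const_mul,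
    Real.zero_rpow ha.ne'] at key
  simp only [Complex.ofReal_zero, zero_mul, sub_zero] at key
  exact (sub_eq_zero.mp key).symm

lemma hasDerivAt_integral_rpow_mul_cexp_neg_mul_Ioi {a : ℝ} (ha : 0 < a) {w : ℂ} (hw : 0 < w.re) :
    HasDerivAt (fun w : ℂ => ∫ r in Ioi (0 : ℝ), ((r ^ (a - 1) : ℝ) : ℂ) * Complex.exp (-w * r))
      (-∫ r in Ioi (0 : ℝ), ((r ^ a : ℝ) : ℂ) * Complex.exp (-w * r)) w := by
  rw [← integral_neg]
  have hs : {v : ℂ | w.re / 2 < v.re} ∈ nhds w :=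
    (isOpen_lt continuous_const Complex.continuous_re).mem_nhds (by simp; linarith)
  refine (hasDerivAt_integral_of_dominated_loc_of_deriv_le
    (F' := fun (v : ℂ) (r : ℝ) => -(((r ^ a : ℝ) : ℂ) * Complex.exp (-v * r)))
    (bound := fun r => r ^ a * Real.exp (-(w.re / 2) * r ^ (1 : ℝ))) hs ?_ ?_ ?_ ?_ ?_ ?_).2
  · exact Eventually.of_forall fun v => (by fun_prop : Measurable
      (fun r : ℝ => ((r ^ (a - 1) : ℝ) : ℂ) * Complex.exp (-v * r))).aestronglyMeasurable
  · exact integrableOn_rpow_mul_cexp_neg_mul_Ioi (by linarith) hw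
  · exact (integrableOn_rpow_mul_cexp_neg_mul_Ioi (by linarith) hw).neg.aestronglyMeasurable
  · filter_upwards [ae_restrict_mem measurableSet_Ioi] with r hr v hv
    have hr : 0 < r := hr
    have hv : w.re / 2 < v.re := hv
    rw [norm_neg, norm_mul, Complex.norm_exp, Complex.norm_real,
      Real.norm_of_nonneg (rpow_nonneg hr.le _)]
    simp only [rpow_one, Complex.mul_re, Complex.neg_re, Complex.ofReal_re, Complex.neg_im,
      Complex.ofReal_im, mul_zero, sub_zero]
    gcongr
  · exact integrableOn_rpow_mul_exp_neg_mul_rpow (by linarith) one_pos (by linarith)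
  · filter_upwards [ae_restrict_mem measurableSet_Ioi] with r hr v hv
    have hr : 0 < r := hr
    have e2 : HasDerivAt (fun v : ℂ => Complex.exp (-v * r))
        (Complex.exp (-v * r) * (-1 * r)) v :=
      ((hasDerivAt_id v).neg.mul_const (r : ℂ)).cexp
    refine (e2.const_mul (((r ^ (a - 1) : ℝ) : ℂ))).congr_deriv ?_
    have : r ^ a = r ^ (a - 1) * r := by
      rw [← Real.rpow_add_one hr.ne']; simp
    rw [this]
    push_cast
    ring

/-- The Gamma integral with a complex rate of positive real part. -/
lemma cpow_mul_integral_rpow_mul_cexp_neg_mul_Ioi {a : ℝ} (ha : 0 < a) {w : ℂ} (hw : 0 < w.re) :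
    w ^ (a : ℂ) * ∫ r in Ioi (0 : ℝ), ((r ^ (a - 1) : ℝ) : ℂ) * Complex.exp (-w * r)
      = Real.Gamma a := by
  have hder : ∀ v ∈ {v : ℂ | 0 < v.re}, HasDerivAt (fun w : ℂ => w ^ (a : ℂ) *
      ∫ r in Ioi (0 : ℝ), ((r ^ (a - 1) : ℝ) : ℂ) * Complex.exp (-w * r)) 0 v := by
    intro v hv
    have hv : 0 < v.re := hv
    have hv0 : v ≠ 0 := by rintro rfl; simp at hv
    have e1 := (hasDerivAt_id v).cpow_const (c := (a : ℂ)) (Or.inl hv)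
    refine (e1.mul (hasDerivAt_integral_rpow_mul_cexp_neg_mul_Ioi ha hv)).congr_deriv ?_
    have := mul_integral_rpow_mul_cexp_neg_mul_Ioi ha hv
    simp only [id]
    have h3 : v ^ (a : ℂ) = v ^ ((a : ℂ) - 1) * v := by
      rw [Complex.cpow_sub _ _ hv0, Complex.cpow_one]; field_simp
    rw [h3]
    linear_combination (-v ^ ((a : ℂ) - 1)) * this
  have hopen : IsOpen {v : ℂ | 0 < v.re} := isOpen_lt continuous_const Complex.continuous_re
  have hc := hopen.is_const_of_deriv_eq_zero (convex_halfSpace_re_gt 0).isPreconnected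
    (fun v hv => (hder v hv).differentiableAt.differentiableWithinAt)
    (fun v hv => (hder v hv).deriv) (x := w) (y := 1) hw (by simp)
  rw [hc, Complex.one_cpow, one_mul, Real.Gamma_eq_integral ha, ← integral_complex_ofReal]
  refine setIntegral_congr_fun measurableSet_Ioi fun r hr => ?_
  push_cast
  ring_nf

lemma isLittleO_rpow_id_atTop {β : ℝ} (hβ : β < 1) :
    (fun x : ℝ => x ^ β) =o[atTop] fun x : ℝ => x := by
  refine Asymptotics.isLittleO_of_tendsto' ?_ ?_
  · filter_upwards [eventually_gt_atTop 0] with x hx h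
    exact absurd h hx.ne'
  · refine (tendsto_rpow_neg_atTop (y := 1 - β) (by linarith)).congr' ?_
    filter_upwards [eventually_gt_atTop 0] with x hx
    rw [neg_sub, Real.rpow_sub_one hx.ne']

/-- The ray issuing from `R` in the direction `d`; together with its complex conjugate it forms a
Hankel contour. -/
noncomputable def hankelRay (R : ℝ) (d : ℂ) (r : ℝ) : ℂ := R + r * d

section HankelRay

variable {R r : ℝ} {d : ℂ}

@[fun_prop]
lemma continuous_hankelRay : Continuous (hankelRay R d) := by
  unfold hankelRay; fun_prop

lemma hasDerivAt_hankelRay : HasDerivAt (hankelRay R d) d r := by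
  have := ((Complex.ofRealCLM.hasDerivAt (x := r)).mul_const d).const_add (R : ℂ)
  exact this.congr_deriv (by simp)

lemma hasDerivAt_hankelRay_base : HasDerivAt (fun R => hankelRay R d r) 1 R := by
  have := (Complex.ofRealCLM.hasDerivAt (x := R)).add_const (r * d)
  exact this.congr_deriv (by simp)

@[simp]
lemma hankelRay_zero : hankelRay R d 0 = R := by simp [hankelRay]

@[simp]
lemma hankelRay_re : (hankelRay R d r).re = R + r * d.re := by simp [hankelRay]

@[simp]
lemma hankelRay_im : (hankelRay R d r).im = r * d.im := by simp [hankelRay]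

lemma norm_hankelRay_le (hd : ‖d‖ = 1) (hR : 0 ≤ R) (hr : 0 ≤ r) : ‖hankelRay R d r‖ ≤ R + r := by
  refine (norm_add_le _ _).trans ?_
  simp [hd, abs_of_nonneg hR, abs_of_nonneg hr]

lemma mul_im_le_norm_hankelRay : r * d.im ≤ ‖hankelRay R d r‖ := by
  have := (le_abs_self _).trans (Complex.abs_im_le_norm (hankelRay R d r))
  simpa using this

lemma base_mul_im_le_norm_hankelRay (hd : ‖d‖ = 1) : R * d.im ≤ ‖hankelRay R d r‖ := by
  refine le_of_sq_le_sq ?_ (norm_nonneg _)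
  rw [← Complex.normSq_eq_norm_sq, Complex.normSq_apply, hankelRay_re, hankelRay_im]
  have h : d.re * d.re + d.im * d.im = 1 := by
    rw [← Complex.normSq_apply, Complex.normSq_eq_norm_sq, hd]; norm_num
  have h' : (R + r * d.re) * (R + r * d.re) + r * d.im * (r * d.im)
      = (R * d.im) ^ 2 + (R * d.re + r) ^ 2 := by linear_combination (r ^ 2 - R ^ 2) * h
  rw [h']
  exact le_add_of_nonneg_right (sq_nonneg _)

lemma hankelRay_mem_slitPlane (hR : 0 < R) (him : 0 < d.im) (hr : 0 ≤ r) :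
    hankelRay R d r ∈ Complex.slitPlane := by
  rcases hr.eq_or_lt with rfl | hr
  · exact Or.inl (by simpa using hR)
  · exact Or.inr (by simp [hr.ne', him.ne'])

lemma norm_hankelRay_pos (hR : 0 < R) (him : 0 < d.im) (hr : 0 ≤ r) : 0 < ‖hankelRay R d r‖ :=
  norm_pos_iff.mpr (Complex.slitPlane_ne_zero (hankelRay_mem_slitPlane hR him hr))

lemma isBigO_hankelRay (hd : ‖d‖ = 1) (hre : d.re < 0) (him : 0 < d.im) (hR : 0 < R)
    (a u : ℝ) {β : ℝ} (hβ : β < 1) :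
    (fun r => Real.exp (hankelRay R d r).re * ‖hankelRay R d r‖ ^ a *
      Real.exp (u * ‖hankelRay R d r‖ ^ β)) =O[atTop] fun r => Real.exp (-(-d.re / 2) * r) := by
  have hlim : Tendsto (fun r => ‖hankelRay R d r‖) atTop atTop :=
    tendsto_atTop_mono (fun r => mul_im_le_norm_hankelRay)
      (tendsto_id.atTop_mul_const him)
  have hε : 0 < -d.re / 8 := by linarith
  have h1 : (fun x : ℝ => a * Real.log x + u * x ^ β) =o[atTop] (fun x : ℝ => x) := by
    refine (Real.isLittleO_log_id_atTop.const_mul_left a).add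
      (Asymptotics.IsLittleO.const_mul_left ?_ u)
    exact isLittleO_rpow_id_atTop hβ
  have h2 := hlim.eventually (h1.bound hε)
  refine Asymptotics.IsBigO.of_bound (Real.exp R) ?_
  filter_upwards [h2, eventually_ge_atTop R] with r h2 hr
  have hr0 : 0 ≤ r := hR.le.trans hr
  have hpos := norm_hankelRay_pos hR him hr0
  have hle := norm_hankelRay_le hd hR.le hr0
  rw [Real.rpow_def_of_pos hpos a, ← Real.exp_add, ← Real.exp_add, Real.norm_of_nonneg (exp_pos _).le,
    Real.norm_of_nonneg (exp_pos _).le, ← Real.exp_add, Real.exp_le_exp, hankelRay_re]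
  have h3 := (le_abs_self _).trans h2
  rw [norm_norm] at h3
  nlinarith [mul_le_mul_of_nonneg_left hle hε.le]

lemma continuousOn_hankelRay_cpow (hR : 0 < R) (him : 0 < d.im) (p : ℂ) :
    ContinuousOn (fun r => hankelRay R d r ^ p) (Ici 0) := fun _ hr =>
  (continuous_hankelRay.continuousAt.cpow continuousAt_const
    (hankelRay_mem_slitPlane hR him hr)).continuousWithinAt

lemma continuousOn_norm_hankelRay_rpow (hR : 0 < R) (him : 0 < d.im) (a : ℝ) :
    ContinuousOn (fun r => ‖hankelRay R d r‖ ^ a) (Ici 0) := fun _ hr =>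
  (continuous_hankelRay.norm.continuousAt.rpow_const
    (Or.inl (norm_hankelRay_pos hR him hr).ne')).continuousWithinAt

lemma integrableOn_hankelRay (hd : ‖d‖ = 1) (hre : d.re < 0) (him : 0 < d.im) (hR : 0 < R)
    (a u : ℝ) {β : ℝ} (hβ : β < 1) :
    IntegrableOn (fun r => Real.exp (hankelRay R d r).re * ‖hankelRay R d r‖ ^ a *
      Real.exp (u * ‖hankelRay R d r‖ ^ β)) (Ioi 0) := by
  refine integrable_of_isBigO_exp_neg (b := -d.re / 2) (by linarith) ?_
    (isBigO_hankelRay hd hre him hR a u hβ)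
  refine ContinuousOn.mul (ContinuousOn.mul ?_ (continuousOn_norm_hankelRay_rpow hR him a))
    (Real.continuous_exp.comp_continuousOn
      (continuousOn_const.mul (continuousOn_norm_hankelRay_rpow hR him β)))
  exact (Real.continuous_exp.comp (Complex.continuous_re.comp continuous_hankelRay)).continuousOn

/-- The integrand of Hankel's formula, with exponent `p`. -/
noncomputable def hankelIntegrand (R : ℝ) (d : ℂ) (p r : ℝ) : ℂ :=
  Complex.exp (hankelRay R d r) * hankelRay R d r ^ (p : ℂ) * d

lemma norm_hankelIntegrand (hd : ‖d‖ = 1) (p : ℝ) :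
    ‖hankelIntegrand R d p r‖ = Real.exp (hankelRay R d r).re * ‖hankelRay R d r‖ ^ p := by
  rw [hankelIntegrand, norm_mul, norm_mul, hd, mul_one, Complex.norm_exp, Complex.norm_cpow_real]

lemma continuousOn_hankelIntegrand (hR : 0 < R) (him : 0 < d.im) (p : ℝ) :
    ContinuousOn (hankelIntegrand R d p) (Ici 0) :=
  ((Complex.continuous_exp.comp continuous_hankelRay).continuousOn.mul
    (continuousOn_hankelRay_cpow hR him p)).mul continuousOn_const

lemma aestronglyMeasurable_hankelIntegrand (hR : 0 < R) (him : 0 < d.im) (p : ℝ) :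
    AEStronglyMeasurable (hankelIntegrand R d p) (volume.restrict (Ioi 0)) :=
  ((continuousOn_hankelIntegrand hR him p).mono Ioi_subset_Ici_self).aestronglyMeasurable
    measurableSet_Ioi

lemma integrableOn_hankelIntegrand (hd : ‖d‖ = 1) (hre : d.re < 0) (him : 0 < d.im) (hR : 0 < R)
    (p : ℝ) : IntegrableOn (hankelIntegrand R d p) (Ioi 0) := by
  refine (integrableOn_hankelRay hd hre him hR p 0 zero_lt_one).mono'
    (aestronglyMeasurable_hankelIntegrand hR him p) (ae_of_all _ fun r => ?_)
  simp [norm_hankelIntegrand hd]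

lemma hasDerivAt_exp_mul_cpow {σ : ℂ} (hσ : σ ∈ Complex.slitPlane) (p : ℝ) :
    HasDerivAt (fun σ : ℂ => Complex.exp σ * σ ^ (p : ℂ))
      (Complex.exp σ * σ ^ (p : ℂ) + p * (Complex.exp σ * σ ^ ((p - 1 : ℝ) : ℂ))) σ := by
  refine ((Complex.hasDerivAt_exp σ).mul
    ((hasDerivAt_id σ).cpow_const (c := (p : ℂ)) hσ)).congr_deriv ?_
  push_cast
  simp only [id]
  ring

lemma integral_hankelIntegrand_add (hd : ‖d‖ = 1) (hre : d.re < 0) (him : 0 < d.im) (hR : 0 < R)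
    (p : ℝ) :
    ∫ r in Ioi (0 : ℝ), (hankelIntegrand R d p r + p * hankelIntegrand R d (p - 1) r)
      = ((-(Real.exp R * R ^ p) : ℝ) : ℂ) := by
  have key := integral_Ioi_of_hasDerivAt_of_tendsto (a := 0) (m := 0)
    (f := fun r : ℝ => Complex.exp (hankelRay R d r) * hankelRay R d r ^ (p : ℂ))
    (f' := fun r => hankelIntegrand R d p r + p * hankelIntegrand R d (p - 1) r) ?_ ?_ ?_ ?_
  · rw [key]
    push_cast
    simp [Complex.ofReal_cpow hR.le]
  · exact ((Complex.continuous_exp.comp continuous_hankelRay).continuousOn.mul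
      (continuousOn_hankelRay_cpow hR him p)) 0 self_mem_Ici
  · intro r hr
    have := (hasDerivAt_exp_mul_cpow (hankelRay_mem_slitPlane hR him (le_of_lt hr)) p).comp r
      (hasDerivAt_hankelRay (R := R) (d := d) (r := r))
    refine this.congr_deriv ?_
    simp only [hankelIntegrand]
    ring
  · exact (integrableOn_hankelIntegrand hd hre him hR p).add
      ((integrableOn_hankelIntegrand hd hre him hR (p - 1)).const_mul _)
  · have h := isBigO_hankelRay hd hre him hR p 0 zero_lt_one
    have h0 : Tendsto (fun r => Real.exp (-(-d.re / 2) * r)) atTop (nhds 0) :=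
      Real.tendsto_exp_atBot.comp (tendsto_id.const_mul_atTop_of_neg (by linarith))
    rw [tendsto_zero_iff_norm_tendsto_zero]
    refine (h.trans_tendsto h0).congr fun r => ?_
    rw [norm_mul, Complex.norm_exp, Complex.norm_cpow_real]
    simp

lemma im_integral_hankelIntegrand_sub_one (hd : ‖d‖ = 1) (hre : d.re < 0) (him : 0 < d.im)
    (hR : 0 < R) (p : ℝ) :
    (∫ r in Ioi (0 : ℝ), hankelIntegrand R d p r).im
      = -p * (∫ r in Ioi (0 : ℝ), hankelIntegrand R d (p - 1) r).im := by
  have h := integral_hankelIntegrand_add hd hre him hR p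
  rw [integral_add (integrableOn_hankelIntegrand hd hre him hR p)
    ((integrableOn_hankelIntegrand hd hre him hR (p - 1)).const_mul _), integral_const_mul] at h
  have := congrArg Complex.im h
  rw [Complex.add_im, Complex.im_ofReal_mul, Complex.ofReal_im] at this
  linarith

lemma hasDerivAt_integral_hankelIntegrand (hd : ‖d‖ = 1) (hre : d.re < 0) (him : 0 < d.im)
    (hR : 0 < R) {p : ℝ} (hp : p < 0) :
    HasDerivAt (fun R => ∫ r in Ioi (0 : ℝ), hankelIntegrand R d p r)
      ((-(Real.exp R * R ^ p) : ℝ) : ℂ) R := by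
  rw [← integral_hankelIntegrand_add hd hre him hR p]
  have hs : Ioo (R / 2) (2 * R) ∈ nhds R := Ioo_mem_nhds (by linarith) (by linarith)
  have hδ : 0 < R / 2 * d.im := by positivity
  refine (hasDerivAt_integral_of_dominated_loc_of_deriv_le
    (F' := fun (R : ℝ) (r : ℝ) => hankelIntegrand R d p r + p * hankelIntegrand R d (p - 1) r)
    (bound := fun r => Real.exp (2 * R) * ((R / 2 * d.im) ^ p + -p * (R / 2 * d.im) ^ (p - 1))
      * Real.exp (d.re * r)) hs ?_ ?_ ?_ ?_ ?_ ?_).2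
  · filter_upwards [hs] with S hS
    exact aestronglyMeasurable_hankelIntegrand (by linarith [hS.1]) him p
  · exact integrableOn_hankelIntegrand hd hre him hR p
  · exact ((integrableOn_hankelIntegrand hd hre him hR p).add
      ((integrableOn_hankelIntegrand hd hre him hR (p - 1)).const_mul _)).aestronglyMeasurable
  · filter_upwards [ae_restrict_mem measurableSet_Ioi] with r hr S hS
    have hσ : R / 2 * d.im ≤ ‖hankelRay S d r‖ :=
      (mul_le_mul_of_nonneg_right hS.1.le him.le).trans (base_mul_im_le_norm_hankelRay hd)
    have hexp : Real.exp (hankelRay S d r).re ≤ Real.exp (2 * R) * Real.exp (d.re * r) := by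
      rw [← Real.exp_add, Real.exp_le_exp, hankelRay_re]
      linarith [hS.2]
    refine (norm_add_le _ _).trans ?_
    rw [norm_mul, norm_hankelIntegrand hd, norm_hankelIntegrand hd, Complex.norm_real,
      Real.norm_of_nonpos hp.le]
    have b1 := Real.rpow_le_rpow_of_nonpos hδ hσ hp.le
    have b2 := Real.rpow_le_rpow_of_nonpos hδ hσ (z := p - 1) (by linarith)
    calc Real.exp (hankelRay S d r).re * ‖hankelRay S d r‖ ^ p
          + -p * (Real.exp (hankelRay S d r).re * ‖hankelRay S d r‖ ^ (p - 1))
        = Real.exp (hankelRay S d r).re *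
          (‖hankelRay S d r‖ ^ p + -p * ‖hankelRay S d r‖ ^ (p - 1)) := by ring
      _ ≤ (Real.exp (2 * R) * Real.exp (d.re * r)) *
          ((R / 2 * d.im) ^ p + -p * (R / 2 * d.im) ^ (p - 1)) := by
          have : 0 ≤ -p := by linarith
          gcongr
      _ = _ := by ring
  · exact (integrableOn_exp_mul_Ioi hre 0).const_mul _
  · filter_upwards [ae_restrict_mem measurableSet_Ioi] with r hr S hS
    have hS0 : 0 < S := by linarith [hS.1]
    have := ((hasDerivAt_exp_mul_cpow (hankelRay_mem_slitPlane hS0 him (le_of_lt hr)) p).comp S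
      (hasDerivAt_hankelRay_base (R := S) (d := d) (r := r))).mul_const d
    refine this.congr_deriv ?_
    simp only [hankelIntegrand]
    ring

lemma im_integral_hankelIntegrand_eq (hd : ‖d‖ = 1) (hre : d.re < 0) (him : 0 < d.im)
    {R S : ℝ} (hR : 0 < R) (hS : 0 < S) {p : ℝ} (hp : p < 0) :
    (∫ r in Ioi (0 : ℝ), hankelIntegrand R d p r).im
      = (∫ r in Ioi (0 : ℝ), hankelIntegrand S d p r).im := by
  have hder : ∀ R ∈ Ioi (0 : ℝ),
      HasDerivAt (fun R => (∫ r in Ioi (0 : ℝ), hankelIntegrand R d p r).im) 0 R := by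
    intro R hR
    have := Complex.imCLM.hasFDerivAt.comp_hasDerivAt R
      (hasDerivAt_integral_hankelIntegrand hd hre him hR hp)
    exact this.congr_deriv (by rw [Complex.imCLM_apply, Complex.ofReal_im])
  exact isOpen_Ioi.is_const_of_deriv_eq_zero isPreconnected_Ioi
    (fun v hv => (hder v hv).differentiableAt.differentiableWithinAt)
    (fun v hv => (hder v hv).deriv) hR hS

end HankelRay

section HankelFormula

variable {R : ℝ} {d : ℂ}

lemma tendsto_integral_hankelIntegrand_base (hd : ‖d‖ = 1) (hre : d.re < 0) (him : 0 < d.im)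
    {p : ℝ} (hp1 : -1 < p) (hp : p < 0) :
    Tendsto (fun R => ∫ r in Ioi (0 : ℝ), hankelIntegrand R d p r) (nhdsWithin 0 (Ioi 0))
      (nhds (∫ r in Ioi (0 : ℝ), hankelIntegrand 0 d p r)) := by
  have hmem : ∀ᶠ R : ℝ in nhdsWithin 0 (Ioi 0), R ∈ Ioo (0 : ℝ) 1 :=
    Ioo_mem_nhdsGT one_pos
  refine tendsto_integral_filter_of_dominated_convergence
    (fun r => Real.exp 1 * d.im ^ p * (r ^ p * Real.exp (-(-d.re) * r ^ (1 : ℝ)))) ?_ ?_ ?_ ?_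
  · filter_upwards [hmem] with R hR
    exact aestronglyMeasurable_hankelIntegrand hR.1 him p
  · filter_upwards [hmem] with R hR
    filter_upwards [ae_restrict_mem measurableSet_Ioi] with r hr
    have hr : 0 < r := hr
    rw [norm_hankelIntegrand hd, neg_neg, Real.rpow_one]
    have b1 := Real.rpow_le_rpow_of_nonpos (mul_pos hr him)
      (mul_im_le_norm_hankelRay (R := R) (d := d) (r := r)) hp.le
    rw [Real.mul_rpow hr.le him.le] at b1
    have b2 : Real.exp (hankelRay R d r).re ≤ Real.exp 1 * Real.exp (d.re * r) := by
      rw [← Real.exp_add, Real.exp_le_exp, hankelRay_re]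
      linarith [hR.2]
    calc _ ≤ (Real.exp 1 * Real.exp (d.re * r)) * (r ^ p * d.im ^ p) := by gcongr
      _ = _ := by ring
  · exact (integrableOn_rpow_mul_exp_neg_mul_rpow hp1 one_pos (by linarith)).const_mul _
  · filter_upwards [ae_restrict_mem measurableSet_Ioi] with r hr
    have hr : 0 < r := hr
    have hc : ContinuousAt (fun R => hankelIntegrand R d p r) 0 := by
      have h0 : ContinuousAt (fun R => hankelRay R d r) 0 := hasDerivAt_hankelRay_base.continuousAt
      refine ContinuousAt.mul (ContinuousAt.mul ?_ ?_) continuousAt_const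
      · exact Complex.continuous_exp.continuousAt.comp h0
      · exact h0.cpow continuousAt_const (Or.inr (by simp [hr.ne', him.ne']))
    exact hc.tendsto.mono_left nhdsWithin_le_nhds

lemma im_integral_hankelIntegrand_zero (hre : d.re < 0) (him : 0 < d.im) {p : ℝ} (hp1 : -1 < p) :
    (∫ r in Ioi (0 : ℝ), hankelIntegrand 0 d p r).im = π / Real.Gamma (-p) := by
  have hd0 : d ≠ 0 := by rintro rfl; simp at him
  have hcongr : ∫ r in Ioi (0 : ℝ), hankelIntegrand 0 d p r
      = ∫ r in Ioi (0 : ℝ), d ^ ((p + 1 : ℝ) : ℂ) *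
          (((r ^ (p + 1 - 1) : ℝ) : ℂ) * Complex.exp (-(-d) * r)) := by
    refine setIntegral_congr_fun measurableSet_Ioi fun r hr => ?_
    have hr : 0 < r := hr
    have hr0 : (r : ℂ) ≠ 0 := by exact_mod_cast hr.ne'
    have h1 : ((r : ℂ) * d) ^ (p : ℂ) = ((r ^ p : ℝ) : ℂ) * d ^ (p : ℂ) := by
      rw [Complex.cpow_def_of_ne_zero (mul_ne_zero hr0 hd0), Complex.log_ofReal_mul hr hd0, add_mul,
        Complex.exp_add, Complex.cpow_def_of_ne_zero hd0, Real.rpow_def_of_pos hr]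
      push_cast
      rfl
    have h2 : d ^ ((p + 1 : ℝ) : ℂ) = d ^ (p : ℂ) * d := by
      push_cast
      rw [Complex.cpow_add _ _ hd0, Complex.cpow_one]
    simp only [hankelIntegrand, hankelRay, Complex.ofReal_zero, zero_add]
    rw [h1, h2, add_sub_cancel_right, neg_neg, mul_comm d]
    ring
  have hG := cpow_mul_integral_rpow_mul_cexp_neg_mul_Ioi (a := p + 1) (by linarith) (w := -d)
    (by simpa using hre)
  have hlog : Complex.log d = Complex.log (-d) + π * Complex.I := by
    rw [Complex.log, Complex.log, norm_neg, Complex.arg_neg_eq_arg_sub_pi_of_im_pos him]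
    push_cast
    ring
  have hpow : d ^ ((p + 1 : ℝ) : ℂ)
      = Complex.exp ((π * (p + 1) : ℝ) * Complex.I) * (-d) ^ ((p + 1 : ℝ) : ℂ) := by
    rw [Complex.cpow_def_of_ne_zero hd0, Complex.cpow_def_of_ne_zero (neg_ne_zero.mpr hd0), hlog,
      ← Complex.exp_add]
    congr 1
    push_cast
    ring
  rw [hcongr, integral_const_mul, hpow, mul_assoc, hG, Complex.im_mul_ofReal,
    Complex.exp_ofReal_mul_I_im]
  have href := Real.Gamma_mul_Gamma_one_sub (p + 1)
  have hg1 : Real.Gamma (p + 1) ≠ 0 := (Real.Gamma_pos_of_pos (by linarith)).ne'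
  rw [show 1 - (p + 1) = -p by ring] at href
  rcases eq_or_ne (Real.sin (π * (p + 1))) 0 with hs | hs
  · rw [hs, div_zero] at href
    rw [hs, (mul_eq_zero.mp href).resolve_left hg1]
    simp
  · have hg2 : Real.Gamma (-p) ≠ 0 := by
      intro h
      rw [h, mul_zero] at href
      exact div_ne_zero Real.pi_ne_zero hs href.symm
    rw [eq_div_iff hs] at href
    rw [eq_div_iff hg2]
    linarith

lemma im_integral_hankelIntegrand_of_mem_Ioo (hd : ‖d‖ = 1) (hre : d.re < 0) (him : 0 < d.im)
    (hR : 0 < R) {p : ℝ} (hp1 : -1 < p) (hp : p < 0) :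
    (∫ r in Ioi (0 : ℝ), hankelIntegrand R d p r).im = π / Real.Gamma (-p) := by
  rw [← im_integral_hankelIntegrand_zero hre him hp1]
  refine tendsto_nhds_unique ?_ ((Complex.continuous_im.tendsto _).comp
    (tendsto_integral_hankelIntegrand_base hd hre him hp1 hp))
  refine tendsto_const_nhds.congr' ?_
  filter_upwards [self_mem_nhdsWithin] with S hS
  exact im_integral_hankelIntegrand_eq hd hre him hR hS hp

lemma im_integral_hankelIntegrand_neg_one (hd : ‖d‖ = 1) (hre : d.re < 0) (him : 0 < d.im)
    (hR : 0 < R) : (∫ r in Ioi (0 : ℝ), hankelIntegrand R d (-1) r).im = π := by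
  rw [im_integral_hankelIntegrand_eq hd hre him hR (inv_pos.mpr him) (by norm_num)]
  set S := d.im⁻¹ with hS
  have hS0 : 0 < S := inv_pos.mpr him
  have hmem : ∀ᶠ p : ℝ in nhdsWithin (-1) (Ioi (-1)), p ∈ Ioo (-1 : ℝ) 0 :=
    Ioo_mem_nhdsGT (by norm_num)
  have hlim : Tendsto (fun p => ∫ r in Ioi (0 : ℝ), hankelIntegrand S d p r)
      (nhdsWithin (-1) (Ioi (-1))) (nhds (∫ r in Ioi (0 : ℝ), hankelIntegrand S d (-1) r)) := by
    refine tendsto_integral_filter_of_dominated_convergence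
      (fun r => Real.exp S * Real.exp (d.re * r)) ?_ ?_ ?_ ?_
    · exact Eventually.of_forall fun p => aestronglyMeasurable_hankelIntegrand hS0 him p
    · filter_upwards [hmem] with p hp
      refine ae_of_all _ fun r => ?_
      have h1 : 1 ≤ ‖hankelRay S d r‖ := by
        have := base_mul_im_le_norm_hankelRay (R := S) (r := r) hd
        rwa [hS, inv_mul_cancel₀ him.ne'] at this
      rw [norm_hankelIntegrand hd, ← Real.exp_add, hankelRay_re, mul_comm r]
      exact mul_le_of_le_one_right (exp_pos _).le (Real.rpow_le_one_of_one_le_of_nonpos h1 hp.2.le)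
    · exact (integrableOn_exp_mul_Ioi hre 0).const_mul _
    · filter_upwards [ae_restrict_mem measurableSet_Ioi] with r hr
      have hne : hankelRay S d r ≠ 0 :=
        Complex.slitPlane_ne_zero (hankelRay_mem_slitPlane hS0 him (le_of_lt hr))
      have hc : ContinuousAt (fun p => hankelIntegrand S d p r) (-1) := by
        refine ContinuousAt.mul (continuousAt_const.mul ?_) continuousAt_const
        exact Complex.continuous_ofReal.continuousAt.const_cpow (Or.inl hne)
      exact hc.tendsto.mono_left nhdsWithin_le_nhds
  have hlim2 : Tendsto (fun p : ℝ => π / Real.Gamma (-p)) (nhdsWithin (-1) (Ioi (-1))) (nhds π) := by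
    have hG : ContinuousAt (fun p : ℝ => Real.Gamma (-p)) (-1) := by
      refine ContinuousAt.comp (g := Real.Gamma) (DifferentiableAt.continuousAt
        (Real.differentiableAt_Gamma fun m => ?_)) continuousAt_neg
      have : (0 : ℝ) ≤ m := m.cast_nonneg
      rw [neg_neg]
      linarith
    have hc : ContinuousAt (fun p : ℝ => π / Real.Gamma (-p)) (-1) :=
      continuousAt_const.div hG (by simp)
    simpa using hc.tendsto.mono_left nhdsWithin_le_nhds
  refine tendsto_nhds_unique (((Complex.continuous_im.tendsto _).comp hlim).congr' ?_) hlim2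
  filter_upwards [hmem] with p hp
  exact im_integral_hankelIntegrand_of_mem_Ioo hd hre him hS0 hp.1 hp.2

/-- **Hankel's formula** for the reciprocal Gamma function, on the real axis. -/
theorem im_integral_hankelIntegrand (hd : ‖d‖ = 1) (hre : d.re < 0) (him : 0 < d.im)
    (hR : 0 < R) (p : ℝ) :
    (∫ r in Ioi (0 : ℝ), hankelIntegrand R d p r).im = π / Real.Gamma (-p) := by
  have hpos : ∀ n : ℕ, ∀ p : ℝ, p < 0 → -(n + 1) ≤ p →
      (∫ r in Ioi (0 : ℝ), hankelIntegrand R d p r).im = π / Real.Gamma (-p) := by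
    intro n
    induction n with
    | zero =>
      intro p hp hp1
      rcases hp1.eq_or_lt with h | h
      · rw [← h]
        simpa using im_integral_hankelIntegrand_neg_one hd hre him hR
      · exact im_integral_hankelIntegrand_of_mem_Ioo hd hre him hR (by simpa using h) hp
    | succ n ih =>
      intro p hp hp1
      push_cast at hp1
      rcases le_or_gt (-1) p with h | h
      · exact ih p hp (by linarith [n.cast_nonneg (α := ℝ)])
      · have h1 := ih (p + 1) (by linarith) (by linarith)
        have h2 := im_integral_hankelIntegrand_sub_one hd hre him hR (p + 1)
        rw [add_sub_cancel_right, h1] at h2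
        have hne : -(p + 1) ≠ 0 := by linarith
        have h3 := Real.Gamma_add_one hne
        rw [show -(p + 1) + 1 = -p by ring] at h3
        have hg : Real.Gamma (-(p + 1)) ≠ 0 := (Real.Gamma_pos_of_pos (by linarith)).ne'
        rw [div_eq_iff hg] at h2
        rw [h3, eq_div_iff (mul_ne_zero hne hg), h2]
        ring
  have hall : ∀ n : ℕ, ∀ p : ℝ, p < n →
      (∫ r in Ioi (0 : ℝ), hankelIntegrand R d p r).im = π / Real.Gamma (-p) := by
    intro n
    induction n with
    | zero =>
      intro p hp
      obtain ⟨m, hm⟩ := exists_nat_ge (-p)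
      exact hpos m p (by simpa using hp) (by linarith)
    | succ n ih =>
      intro p hp
      push_cast at hp
      have h1 := ih (p - 1) (by linarith)
      rw [im_integral_hankelIntegrand_sub_one hd hre him hR p, h1]
      rcases eq_or_ne p 0 with rfl | hne
      · simp
      · rw [show -(p - 1) = -p + 1 by ring, Real.Gamma_add_one (neg_ne_zero.mpr hne)]
        have := neg_ne_zero.mpr hne
        rw [mul_div_assoc', mul_div_mul_left _ _ this]
  obtain ⟨n, hn⟩ := exists_nat_gt p
  exact hall n p hn

end HankelFormula

section Wright

variable {R : ℝ} {d : ℂ}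

lemma hankelIntegrand_mul_cpow_pow {p q r : ℝ} (hσ : hankelRay R d r ≠ 0) (k : ℕ) :
    hankelIntegrand R d p r * (hankelRay R d r ^ (q : ℂ)) ^ k
      = hankelIntegrand R d (p + q * k) r := by
  simp only [hankelIntegrand]
  push_cast
  rw [Complex.cpow_add _ _ hσ, mul_comm (q : ℂ), Complex.cpow_nat_mul]
  ring

lemma measurable_hankelIntegrand (p : ℝ) : Measurable (hankelIntegrand R d p) := by
  unfold hankelIntegrand hankelRay
  fun_prop

lemma arg_hankelRay_nonneg (him : 0 < d.im) {r : ℝ} (hr : 0 ≤ r) :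
    0 ≤ (hankelRay R d r).arg := by
  rw [Complex.arg_nonneg_iff, hankelRay_im]
  positivity

lemma arg_hankelRay_le (hd : ‖d‖ = 1) (him : 0 < d.im) (hR : 0 < R) {r : ℝ} (hr : 0 ≤ r) :
    (hankelRay R d r).arg ≤ d.arg := by
  have hd0 : d ≠ 0 := by rintro rfl; simp at him
  have hσ := norm_hankelRay_pos hR him hr
  by_contra! h
  have h1 : 0 < d.arg := by
    refine (Complex.arg_nonneg_iff.mpr him.le).lt_of_ne fun h0 => ?_
    exact him.ne' (Complex.arg_eq_zero_iff.mp h0.symm).2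
  have hneg := Real.sin_neg_of_neg_of_neg_pi_lt (x := d.arg - (hankelRay R d r).arg)
    (by linarith) (by linarith [Complex.arg_le_pi (hankelRay R d r)])
  rw [Real.sin_sub, Complex.sin_arg, Complex.sin_arg, Complex.cos_arg hd0,
    Complex.cos_arg (norm_pos_iff.mp hσ), hankelRay_re, hankelRay_im, hd] at hneg
  have : d.im / 1 * ((R + r * d.re) / ‖hankelRay R d r‖)
      - d.re / 1 * (r * d.im / ‖hankelRay R d r‖) = d.im * R / ‖hankelRay R d r‖ := by
    field_simp
    ring
  rw [this] at hneg
  exact absurd hneg (not_lt.mpr (by positivity))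

lemma mul_norm_rpow_le_re_hankelRay_cpow (hd : ‖d‖ = 1) (him : 0 < d.im) (hR : 0 < R) {β : ℝ}
    (hβ : 0 < β) (hβd : d.arg * β < π / 2) {r : ℝ} (hr : 0 ≤ r) :
    Real.cos (d.arg * β) * ‖hankelRay R d r‖ ^ β ≤ (hankelRay R d r ^ (β : ℂ)).re := by
  rw [Complex.cpow_ofReal_re, mul_comm]
  refine mul_le_mul_of_nonneg_left ?_ (rpow_nonneg (norm_nonneg _) _)
  refine Real.cos_le_cos_of_nonneg_of_le_pi (mul_nonneg (arg_hankelRay_nonneg him hr) hβ.le)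
    (by linarith [Real.pi_pos]) ?_
  exact mul_le_mul_of_nonneg_right (arg_hankelRay_le hd him hR hr) hβ.le

/-- The Wright function `M_β(u) = ∑_k (-u)^k / (k! Γ(1 - β(k+1)))`. -/
noncomputable def wrightM (β u : ℝ) : ℝ :=
  ∑' k : ℕ, (-u) ^ k / ((Nat.factorial k : ℝ) * Real.Gamma (1 - β * (k + 1)))

lemma pi_mul_wrightM (hd : ‖d‖ = 1) (hre : d.re < 0) (him : 0 < d.im) (hR : 0 < R) {β : ℝ}
    (hβ : β < 1) (u : ℝ) :
    π * wrightM β u = (∫ r in Ioi (0 : ℝ), hankelIntegrand R d (β - 1) r *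
      Complex.exp (-u * hankelRay R d r ^ (β : ℂ))).im := by
  have hsum : ∀ r : ℝ, HasSum (fun k : ℕ => ‖hankelIntegrand R d (β - 1) r‖ *
      ((|u| * ‖hankelRay R d r‖ ^ β) ^ k / (Nat.factorial k : ℝ)))
      (Real.exp (hankelRay R d r).re * ‖hankelRay R d r‖ ^ (β - 1) *
        Real.exp (|u| * ‖hankelRay R d r‖ ^ β)) := by
    intro r
    rw [norm_hankelIntegrand hd]
    refine HasSum.mul_left _ ?_
    have := NormedSpace.expSeries_div_hasSum_exp (|u| * ‖hankelRay R d r‖ ^ β)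
    rwa [← Real.exp_eq_exp_ℝ] at this
  have h := hasSum_integral_of_dominated_convergence (μ := volume.restrict (Ioi (0 : ℝ)))
    (F := fun (k : ℕ) (r : ℝ) => ((((-u) ^ k / (Nat.factorial k : ℝ) : ℝ)) : ℂ) *
      hankelIntegrand R d (β * (k + 1) - 1) r)
    (f := fun r => hankelIntegrand R d (β - 1) r *
      Complex.exp (-u * hankelRay R d r ^ (β : ℂ)))
    (fun (k : ℕ) (r : ℝ) => ‖hankelIntegrand R d (β - 1) r‖ *
      ((|u| * ‖hankelRay R d r‖ ^ β) ^ k / (Nat.factorial k : ℝ))) ?_ ?_ ?_ ?_ ?_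
  · simp only [integral_const_mul] at h
    have h2 := Complex.hasSum_im h
    have h3 : ∀ k : ℕ, (((((-u) ^ k / (Nat.factorial k : ℝ) : ℝ)) : ℂ) *
        ∫ r in Ioi (0 : ℝ), hankelIntegrand R d (β * (k + 1) - 1) r).im
        = π * ((-u) ^ k / ((Nat.factorial k : ℝ) * Real.Gamma (1 - β * (k + 1)))) := by
      intro k
      rw [Complex.im_ofReal_mul, im_integral_hankelIntegrand hd hre him hR, neg_sub, ← div_div]
      ring
    simp only [h3] at h2
    rw [wrightM, ← tsum_mul_left, h2.tsum_eq]
  · exact fun k => (aestronglyMeasurable_hankelIntegrand hR him _).const_mul _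
  · intro k
    filter_upwards [ae_restrict_mem measurableSet_Ioi] with r hr
    have hpos := norm_hankelRay_pos hR him (le_of_lt hr)
    rw [show β * ((k : ℝ) + 1) - 1 = (β - 1) + β * k by ring,
      ← hankelIntegrand_mul_cpow_pow (norm_pos_iff.mp hpos), norm_mul, norm_mul, norm_pow,
      Complex.norm_cpow_real, Complex.norm_real, norm_div, norm_pow, norm_neg, mul_pow,
      Real.norm_eq_abs, Real.norm_natCast]
    exact le_of_eq (by ring)
  · exact ae_of_all _ fun r => (hsum r).summable
  · simp only [(hsum _).tsum_eq]
    exact integrableOn_hankelRay hd hre him hR (β - 1) |u| hβ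
  · filter_upwards [ae_restrict_mem measurableSet_Ioi] with r hr
    have hpos := norm_hankelRay_pos hR him (le_of_lt hr)
    have := (NormedSpace.expSeries_div_hasSum_exp
      (-(u : ℂ) * hankelRay R d r ^ (β : ℂ))).mul_left (hankelIntegrand R d (β - 1) r)
    rw [← Complex.exp_eq_exp_ℂ] at this
    convert! this using 1
    ext k
    rw [show β * ((k : ℝ) + 1) - 1 = (β - 1) + β * k by ring,
      ← hankelIntegrand_mul_cpow_pow (norm_pos_iff.mp hpos), mul_pow]
    push_cast
    ring

lemma hasSum_integral_hankelIntegrand_geometric (hd : ‖d‖ = 1) (hre : d.re < 0) (him : 0 < d.im)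
    (hR : 0 < R) {β lam : ℝ} (hbig : ∀ r, 0 ≤ r → 2 * |lam| ≤ ‖hankelRay R d r‖ ^ β)  :
    HasSum (fun n : ℕ => π * (lam ^ n / Real.Gamma (β * n + 1)))
      (∫ r in Ioi (0 : ℝ), hankelIntegrand R d (β - 1) r *
        (hankelRay R d r ^ (β : ℂ) - lam)⁻¹).im := by
  have hsmall : ∀ r, 0 ≤ r → ‖(lam : ℂ) * hankelRay R d r ^ ((-β : ℝ) : ℂ)‖ ≤ 1 / 2 := by
    intro r hr
    have hpos := norm_hankelRay_pos hR him hr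
    rw [norm_mul, Complex.norm_cpow_real, Complex.norm_real, Real.norm_eq_abs,
      Real.rpow_neg hpos.le, ← div_eq_mul_inv, div_le_iff₀ (Real.rpow_pos_of_pos hpos _)]
    linarith [hbig r hr]
  have h := hasSum_integral_of_dominated_convergence (μ := volume.restrict (Ioi (0 : ℝ)))
    (F := fun (n : ℕ) (r : ℝ) => (((lam ^ n : ℝ)) : ℂ) * hankelIntegrand R d (-1 + -β * n) r)
    (f := fun r => hankelIntegrand R d (β - 1) r * (hankelRay R d r ^ (β : ℂ) - lam)⁻¹)
    (fun (n : ℕ) (r : ℝ) => ‖hankelIntegrand R d (-1) r‖ * (1 / 2) ^ n) ?_ ?_ ?_ ?_ ?_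
  · simp only [integral_const_mul] at h
    have h2 := Complex.hasSum_im h
    have h3 : ∀ n : ℕ, ((((lam ^ n : ℝ)) : ℂ) *
        ∫ r in Ioi (0 : ℝ), hankelIntegrand R d (-1 + -β * n) r).im
        = π * (lam ^ n / Real.Gamma (β * n + 1)) := by
      intro n
      rw [Complex.im_ofReal_mul, im_integral_hankelIntegrand hd hre him hR,
        show -(-1 + -β * (n : ℝ)) = β * n + 1 by ring]
      ring
    simpa only [h3] using h2
  · exact fun k => (aestronglyMeasurable_hankelIntegrand hR him _).const_mul _
  · intro n
    filter_upwards [ae_restrict_mem measurableSet_Ioi] with r hr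
    have hpos := norm_hankelRay_pos hR him (le_of_lt hr)
    rw [← hankelIntegrand_mul_cpow_pow (norm_pos_iff.mp hpos), mul_left_comm, norm_mul]
    push_cast
    rw [← mul_pow, norm_pow]
    gcongr
    simpa using hsmall r (le_of_lt hr)
  · exact ae_of_all _ fun r => summable_geometric_two.mul_left _
  · simp only [tsum_mul_left]
    exact (integrableOn_hankelIntegrand hd hre him hR (-1)).norm.mul_const _
  · filter_upwards [ae_restrict_mem measurableSet_Ioi] with r hr
    have hpos := norm_hankelRay_pos hR him (le_of_lt hr)
    have hne := norm_pos_iff.mp hpos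
    have hlt := (hsmall r (le_of_lt hr)).trans_lt (by norm_num : (1 / 2 : ℝ) < 1)
    have hg := (hasSum_geometric_of_norm_lt_one hlt).mul_left (hankelIntegrand R d (-1) r)
    have hval : hankelIntegrand R d (-1) r * (1 - lam * hankelRay R d r ^ ((-β : ℝ) : ℂ))⁻¹
        = hankelIntegrand R d (β - 1) r * (hankelRay R d r ^ (β : ℂ) - lam)⁻¹ := by
      have h1 := hankelIntegrand_mul_cpow_pow (p := -1) (q := β) hne 1
      rw [Nat.cast_one, mul_one, pow_one, neg_add_eq_sub] at h1
      have hz : hankelRay R d r ^ (β : ℂ) ≠ 0 := by simp [Complex.cpow_eq_zero_iff, hne]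
      rw [← h1, Complex.ofReal_neg, Complex.cpow_neg, mul_assoc]
      congr 1
      rw [← div_eq_mul_inv (hankelRay R d r ^ (β : ℂ)), ← inv_div]
      congr 1
      rw [sub_div, div_self hz, div_eq_mul_inv]
    rw [hval] at hg
    convert! hg using 1
    ext n
    rw [← hankelIntegrand_mul_cpow_pow hne, mul_pow]
    push_cast
    ring

/-- The exponential transform of the Wright function is the Mittag-Leffler function. -/
theorem wrightM_exp {β : ℝ} (hβ0 : 0 < β) (hβ1 : β < 1) (lam : ℝ) :
    IntegrableOn (fun u => wrightM β u * Real.exp (lam * u)) (Ioi 0) ∧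
      HasSum (fun n : ℕ => lam ^ n / Real.Gamma (β * n + 1))
        (∫ u in Ioi (0 : ℝ), wrightM β u * Real.exp (lam * u)) := by
  obtain ⟨ψ, hψ1, hψ2⟩ : ∃ ψ, π / 2 < ψ ∧ ψ < min π (π / 2 / β) := by
    refine exists_between (lt_min (by linarith [Real.pi_pos]) ?_)
    rw [lt_div_iff₀ hβ0]
    nlinarith [Real.pi_pos]
  have hψπ := hψ2.trans_le (min_le_left _ _)
  have hψβ := hψ2.trans_le (min_le_right _ _)
  rw [lt_div_iff₀ hβ0] at hψβ
  have hψ0 : 0 < ψ := by linarith [Real.pi_pos]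
  obtain ⟨d, hd, hre, him, harg⟩ : ∃ d : ℂ, ‖d‖ = 1 ∧ d.re < 0 ∧ 0 < d.im ∧ d.arg = ψ := by
    refine ⟨Complex.exp (ψ * Complex.I), Complex.norm_exp_ofReal_mul_I ψ, ?_, ?_, ?_⟩
    · rw [Complex.exp_ofReal_mul_I_re]
      exact Real.cos_neg_of_pi_div_two_lt_of_lt hψ1 (by linarith)
    · rw [Complex.exp_ofReal_mul_I_im]
      exact Real.sin_pos_of_pos_of_lt_pi hψ0 hψπ
    · rw [Complex.arg_exp_mul_I, toIocMod_eq_self]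
      exact ⟨by linarith, by linarith⟩
  have hβd : d.arg * β < π / 2 := by rwa [harg]
  set c := Real.cos (d.arg * β) with hc
  have hcpos : 0 < c := Real.cos_pos_of_mem_Ioo
    ⟨by rw [harg]; nlinarith [Real.pi_pos, mul_pos hψ0 hβ0], hβd⟩
  set K := max 1 (max (2 * |lam|) ((|lam| + 1) / c)) with hK
  have hK1 : 1 ≤ K := le_max_left _ _
  have hK2 : 2 * |lam| ≤ K := (le_max_left _ _).trans (le_max_right _ _)
  have hK3 : (|lam| + 1) / c ≤ K := (le_max_right _ _).trans (le_max_right _ _)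
  have hK0 : 0 < K := by linarith
  set R := K ^ β⁻¹ / d.im with hRdef
  have hR : 0 < R := by positivity
  have hnorm : ∀ r : ℝ, K ^ β⁻¹ ≤ ‖hankelRay R d r‖ := fun r => by
    have := base_mul_im_le_norm_hankelRay (R := R) (r := r) hd
    rwa [hRdef, div_mul_cancel₀ _ him.ne'] at this
  have hnorm1 : ∀ r : ℝ, 1 ≤ ‖hankelRay R d r‖ := fun r =>
    (Real.one_le_rpow hK1 (by positivity)).trans (hnorm r)
  have hnormβ : ∀ r : ℝ, K ≤ ‖hankelRay R d r‖ ^ β := fun r => by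
    have := Real.rpow_le_rpow (by positivity) (hnorm r) hβ0.le
    rwa [Real.rpow_inv_rpow hK0.le hβ0.ne'] at this
  have hrecpow : ∀ r : ℝ, 0 ≤ r → |lam| + 1 ≤ (hankelRay R d r ^ (β : ℂ)).re := fun r hr => by
    refine le_trans ?_ (mul_norm_rpow_le_re_hankelRay_cpow hd him hR hβ0 hβd hr)
    rw [div_le_iff₀' hcpos] at hK3
    exact hK3.trans (mul_le_mul_of_nonneg_left (hnormβ r) hcpos.le)
  set f : ℝ → ℝ → ℂ := fun u r => hankelIntegrand R d (β - 1) r *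
    Complex.exp ((lam - hankelRay R d r ^ (β : ℂ)) * u) with hf
  have hmeas : Measurable (Function.uncurry f) := by
    have h1 : Measurable fun z : ℝ × ℝ => hankelIntegrand R d (β - 1) z.2 :=
      (measurable_hankelIntegrand _).comp measurable_snd
    have h2 : Measurable fun z : ℝ × ℝ => hankelRay R d z.2 :=
      continuous_hankelRay.measurable.comp measurable_snd
    exact h1.mul (by fun_prop)
  have hint : Integrable (Function.uncurry f)
      ((volume.restrict (Ioi (0 : ℝ))).prod (volume.restrict (Ioi (0 : ℝ)))) := by
    have hb : Integrable (fun z : ℝ × ℝ => Real.exp ((-1) * z.1) *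
        (Real.exp R * Real.exp (d.re * z.2)))
        ((volume.restrict (Ioi (0 : ℝ))).prod (volume.restrict (Ioi (0 : ℝ)))) :=
      Integrable.mul_prod (f := fun u : ℝ => Real.exp ((-1) * u))
        (g := fun r : ℝ => Real.exp R * Real.exp (d.re * r))
        (integrableOn_exp_mul_Ioi (by norm_num) 0) ((integrableOn_exp_mul_Ioi hre 0).const_mul _)
    refine hb.mono' hmeas.aestronglyMeasurable ?_
    rw [Measure.prod_restrict]
    filter_upwards [ae_restrict_mem (measurableSet_Ioi.prod measurableSet_Ioi)] with z hz
    obtain ⟨u, r⟩ := z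
    have hu : 0 < u := hz.1
    have hr : 0 < r := hz.2
    simp only [Function.uncurry_apply_pair, hf]
    rw [norm_mul, norm_hankelIntegrand hd, Complex.norm_exp, mul_comm]
    refine mul_le_mul (Real.exp_le_exp.mpr ?_) ?_ (by positivity) (by positivity)
    · rw [Complex.re_mul_ofReal, Complex.sub_re, Complex.ofReal_re]
      have := hrecpow r hr.le
      have := le_abs_self lam
      nlinarith
    · rw [← Real.exp_add, hankelRay_re, mul_comm r]
      exact mul_le_of_le_one_right (exp_pos _).le
        (Real.rpow_le_one_of_one_le_of_nonpos (hnorm1 r) (by linarith))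
  have hM : ∀ u : ℝ, π * (wrightM β u * Real.exp (lam * u))
      = (∫ r in Ioi (0 : ℝ), f u r).im := by
    intro u
    rw [← mul_assoc, pi_mul_wrightM hd hre him hR hβ1 u, ← Complex.im_mul_ofReal,
      ← integral_mul_const]
    congr 2
    ext r
    rw [mul_assoc, Complex.ofReal_exp, ← Complex.exp_add]
    simp only [hf]
    congr 2
    push_cast
    ring
  have hintL := hint.integral_prod_left
  have hintM : IntegrableOn (fun u => π * (wrightM β u * Real.exp (lam * u))) (Ioi 0) := by
    simp only [hM]
    exact hintL.im
  refine ⟨?_, ?_⟩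
  · have := hintM.const_mul π⁻¹
    refine this.congr (ae_of_all _ fun u => ?_)
    simp only
    rw [inv_mul_cancel_left₀ Real.pi_ne_zero]
  · have hval : π * ∫ u in Ioi (0 : ℝ), wrightM β u * Real.exp (lam * u)
        = (∫ r in Ioi (0 : ℝ), hankelIntegrand R d (β - 1) r *
          (hankelRay R d r ^ (β : ℂ) - lam)⁻¹).im := by
      rw [← integral_const_mul]
      simp only [hM]
      have h1 := integral_im hintL
      simp only [RCLike.im_to_complex, Function.uncurry_apply_pair] at h1
      rw [h1, integral_integral_swap hint]
      congr 1
      refine setIntegral_congr_fun measurableSet_Ioi fun r hr => ?_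
      simp only [hf]
      rw [integral_const_mul, integral_exp_mul_complex_Ioi]
      · rw [← neg_sub (lam : ℂ), inv_neg]
        simp [neg_div]
      · rw [Complex.sub_re, Complex.ofReal_re]
        linarith [hrecpow r (le_of_lt hr), le_abs_self lam]
    have hs := hasSum_integral_hankelIntegrand_geometric hd hre him hR (β := β) (lam := lam)
      (fun r _ => hK2.trans (hnormβ r))
    rw [← hval] at hs
    exact (hasSum_mul_left_iff Real.pi_ne_zero).mp hs

end Wright

lemma hasSum_integral_wrightM_mul_cosh {β : ℝ} (hβ0 : 0 < β) (hβ1 : β < 1) (lam : ℝ) :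
    HasSum (fun n : ℕ => lam ^ (2 * n) / Real.Gamma (2 * β * n + 1))
      (∫ u in Ioi (0 : ℝ), wrightM β u * Real.cosh (lam * u)) := by
  obtain ⟨i1, s1⟩ := wrightM_exp hβ0 hβ1 lam
  obtain ⟨i2, s2⟩ := wrightM_exp hβ0 hβ1 (-lam)
  have hI : ∫ u in Ioi (0 : ℝ), wrightM β u * Real.cosh (lam * u)
      = (1 / 2) * ((∫ u in Ioi (0 : ℝ), wrightM β u * Real.exp (lam * u))
        + ∫ u in Ioi (0 : ℝ), wrightM β u * Real.exp (-lam * u)) := by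
    rw [← integral_add i1 i2, ← integral_const_mul]
    congr 1
    ext u
    rw [Real.cosh_eq, neg_mul]
    ring
  rw [hI]
  have hs := (s1.add s2).mul_left (1 / 2)
  have hinj : Function.Injective fun n : ℕ => 2 * n := fun a b h => by simpa using h
  convert! (hinj.hasSum_iff fun n hn => ?_).mpr hs using 1
  · ext n
    simp only [Function.comp_apply]
    rw [(even_two_mul n).neg_pow]
    push_cast
    rw [show β * (2 * (n : ℝ)) = 2 * β * n by ring]
    ring
  · have hodd : Odd n := by
      rw [← Nat.not_even_iff_odd]
      rintro ⟨m, rfl⟩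
      exact hn ⟨m, by simp only; ring⟩
    rw [hodd.neg_pow]
    ring

lemma wrightG_eq_wrightM {β x t : ℝ} : wrightG β x t = t ^ (-β) * wrightM β (x / t ^ β) := by
  rw [wrightG, wrightM, neg_div]

/-- Wright-type transform of the hyperbolic cosine:
`∫_0^∞ g_β(s;t) cosh s ds = E_{2β}(t^{2β}) = ∑ t^{2nβ}/Γ(2nβ+1)`. -/
theorem wrightTransform_cosh (β t : ℝ) (hβ0 : 0 < β) (hβ1 : β < 1) (ht : 0 < t) :
    (∫ s in Set.Ioi (0:ℝ), wrightG β s t * Real.cosh s)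
        = mittagLeffler (2 * β) 1 (t ^ (2 * β)) ∧
      mittagLeffler (2 * β) 1 (t ^ (2 * β))
        = ∑' n : ℕ, t ^ (2 * (n : ℝ) * β) / Real.Gamma (2 * (n : ℝ) * β + 1) := by
  have hT : 0 < t ^ β := Real.rpow_pos_of_pos ht β
  constructor
  · have hsub := integral_comp_mul_left_Ioi
      (fun s => wrightM β (s / t ^ β) * Real.cosh s) 0 hT
    simp only [mul_div_cancel_left₀ _ hT.ne', mul_zero, smul_eq_mul] at hsub
    have hL : ∫ s in Set.Ioi (0 : ℝ), wrightG β s t * Real.cosh s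
        = ∫ u in Ioi (0 : ℝ), wrightM β u * Real.cosh (t ^ β * u) := by
      rw [hsub, ← integral_const_mul]
      simp only [wrightG_eq_wrightM, Real.rpow_neg ht.le, mul_assoc]
    rw [hL, ← (hasSum_integral_wrightM_mul_cosh hβ0 hβ1 (t ^ β)).tsum_eq, mittagLeffler]
    refine tsum_congr fun n => ?_
    rw [pow_mul, ← Real.rpow_mul_natCast ht.le β 2, mul_comm β]
    norm_num
  · rw [mittagLeffler]
    refine tsum_congr fun n => ?_
    rw [← Real.rpow_mul_natCast ht.le, mul_right_comm 2 β]
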